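/- arXiv:2202.06298 — 2 statements merged into one kernel-verified Lean document; each statement's English description precedes it below -/
import Mathlib

section
/- An idempotent e of a semigroup X is viable (i.e., H_e/e is a coideal in X) if and only if H_e/e = ⇑e. In this case H_e is an ideal of the semigroup ⇑e and e commutes with every element of ⇑e. -/
universe u

/-- The binary quasiorder `x ≲ y` on a semigroup `X`: `χ x ≤ χ y` for every semigroup
homomorphism `χ : X → 𝟐`, where the two-element semilattice `𝟐 = {0,1}` (with multiplication
inherited from `ℤ`) is represented by `Bool` (with `* = and`, `false ≤ true`). -/
def binLe {X : Type u} [Semigroup X] (x y : X) : Prop :=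
  ∀ χ : X →ₙ* Bool, χ x ≤ χ y

/-- The `𝟐`-class `⇕a = {x | a ≲ x ≲ a}`. -/
def twoClass {X : Type u} [Semigroup X] (a : X) : Set X :=
  {x | binLe a x ∧ binLe x a}

/-- The upper `𝟐`-class `⇑a = {x | a ≲ x}`. -/
def upClass {X : Type u} [Semigroup X] (a : X) : Set X :=
  {x | binLe a x}

/-- The `ℋ`-class of `e`: `{x ∈ X | xX¹ = eX¹ ∧ X¹x = X¹e}`, where `X¹ = WithOne X` is `X`
with an identity adjoined. For an idempotent `e` this is the maximal subgroup containing `e`. -/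
def HClass {X : Type u} [Semigroup X] (e : X) : Set X :=
  {x | (Set.range fun z : WithOne X => (x : WithOne X) * z) =
         (Set.range fun z : WithOne X => (e : WithOne X) * z) ∧
       (Set.range fun z : WithOne X => z * (x : WithOne X)) =
         (Set.range fun z : WithOne X => z * (e : WithOne X))}

/-- `spow x n = x^(n+1)`: the positive powers of an element of a semigroup. -/
def spow {X : Type u} [Semigroup X] (x : X) : ℕ → X
  | 0 => x
  | n + 1 => spow x n * x

/-- `rootInf A = √∞A = {x | x^n ∈ A for some positive integer n}`. -/
def rootInf {X : Type u} [Semigroup X] (A : Set X) : Set X :=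
  {x | ∃ n : ℕ, spow x n ∈ A}

/-- `I` is an ideal of the semigroup `X`: `IX ∪ XI ⊆ I`. -/
def IsIdealSet {X : Type u} [Semigroup X] (I : Set X) : Prop :=
  ∀ a ∈ I, ∀ x : X, a * x ∈ I ∧ x * a ∈ I

/-- A prime coideal: the complement is an ideal and the set itself is a subsemigroup. -/
def IsPrimeCoideal {X : Type u} [Semigroup X] (C : Set X) : Prop :=
  IsIdealSet Cᶜ ∧ ∀ a b : X, a ∈ C → b ∈ C → a * b ∈ C

/-- A semigroup is `𝟐`-trivial if every homomorphism to the two-element semilattice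
`𝟐` is constant. -/
def TwoTrivial (X : Type u) [Semigroup X] : Prop :=
  ∀ χ : X →ₙ* Bool, ∀ a b : X, χ a = χ b

/-- `X` is `E`-separated: distinct idempotents are separated by a homomorphism to a
semilattice (a commutative semigroup of idempotents). -/
def ESeparated (X : Type u) [Semigroup X] : Prop :=
  ∀ x y : X, x * x = x → y * y = y → x ≠ y →
    ∃ (Y : Type u) (mul : Y → Y → Y) (h : X → Y),
      (∀ a b c : Y, mul (mul a b) c = mul a (mul b c)) ∧
      (∀ a b : Y, mul a b = mul b a) ∧
      (∀ a : Y, mul a a = a) ∧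
      (∀ a b : X, h (a * b) = mul (h a) (h b)) ∧
      h x ≠ h y

/-- `X` is duo: `xX = Xx` for every `x ∈ X`. -/
def IsDuo (X : Type u) [Semigroup X] : Prop :=
  ∀ x : X, (Set.range fun a : X => x * a) = (Set.range fun a : X => a * x)

/-- `X` is viable: whenever `xy` and `yx` are both idempotents, `xy = yx`. -/
def Viable (X : Type u) [Semigroup X] : Prop :=
  ∀ x y : X, (x * y) * (x * y) = x * y → (y * x) * (y * x) = y * x → x * y = y * x

/-- `H_e/e = {x ∈ X | xe = ex ∈ H_e}`. -/
def HeOverE {X : Type u} [Semigroup X] (e : X) : Set X :=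
  {x | x * e = e * x ∧ e * x ∈ HClass e}

/-- `X` is `E`-viable: `H_e/e` is a coideal for every idempotent `e`. -/
def EViable (X : Type u) [Semigroup X] : Prop :=
  ∀ e : X, e * e = e → IsIdealSet (HeOverE e)ᶜ

/-- `X` is `E⇑`-central: `ex = xe` for every idempotent `e` and every `x ∈ ⇑e`. -/
def EUpArrowCentral (X : Type u) [Semigroup X] : Prop :=
  ∀ e : X, e * e = e → ∀ x ∈ upClass e, e * x = x * e

/-- `X` is `E`-hypercentral. -/
def EHypercentral (X : Type u) [Semigroup X] : Prop :=
  ∀ e x y : X, e * e = e → x * y = e → x * e = e * x ∧ y * e = e * y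

/-- `X` is `E`-hypocentral. -/
def EHypocentral (X : Type u) [Semigroup X] : Prop :=
  ∀ e x y : X, e * e = e → x * y = e → x * e = e * x ∨ y * e = e * y

/-- `X` is `E`-upcentral. -/
def EUpcentral (X : Type u) [Semigroup X] : Prop :=
  ∀ e f : X, e * e = e → f * f = f → f * e = e → e * f = e →
    ∀ x ∈ rootInf (HClass f), x * e = e * x

/-- `X` is `E`-commutative: idempotents commute. -/
def ECommutative (X : Type u) [Semigroup X] : Prop :=
  ∀ e f : X, e * e = e → f * f = f → e * f = f * e

/-- The Clifford part `H(X) = ⋃_{e ∈ E(X)} H_e`. -/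
def CliffordPart (X : Type u) [Semigroup X] : Set X :=
  {x | ∃ e : X, e * e = e ∧ x ∈ HClass e}

theorem hclass_iff_aux {X : Type u} [Semigroup X] (e : X) (he : e * e = e) (x : X) :
    x ∈ HClass e ↔ e * x = x ∧ x * e = x ∧ ∃ y : X, e * y = y ∧ y * e = y ∧ x * y = e ∧ y * x = e := by
  have heM : (e : WithOne X) * e = e := by rw [← WithOne.coe_mul, he]
  constructor
  · rintro ⟨h1, h2⟩
    have hx1 : (x : WithOne X) ∈ Set.range fun z : WithOne X => (e : WithOne X) * z :=
      h1 ▸ ⟨1, mul_one _⟩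
    have hx2 : (x : WithOne X) ∈ Set.range fun z : WithOne X => z * (e : WithOne X) :=
      h2 ▸ ⟨1, one_mul _⟩
    have he1 : (e : WithOne X) ∈ Set.range fun z : WithOne X => (x : WithOne X) * z :=
      h1.symm ▸ ⟨1, mul_one _⟩
    have he2 : (e : WithOne X) ∈ Set.range fun z : WithOne X => z * (x : WithOne X) :=
      h2.symm ▸ ⟨1, one_mul _⟩
    obtain ⟨a, ha⟩ := hx1
    obtain ⟨b, hb⟩ := hx2
    obtain ⟨z, hz⟩ := he1
    obtain ⟨w, hw⟩ := he2
    dsimp only at ha hb hz hw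
    have ex : (e : WithOne X) * x = x := by rw [← ha, ← mul_assoc, heM]
    have xe : (x : WithOne X) * e = x := by rw [← hb, mul_assoc, heM]
    have key : ∀ z : WithOne X, ∃ y : X, (y : WithOne X) = e * z * e := by
      intro z
      refine WithOne.cases_on z ?_ ?_
      · exact ⟨e, by rw [mul_one, heM]⟩
      · intro c
        exact ⟨e * c * e, by simp⟩
    obtain ⟨y, hy⟩ := key z
    obtain ⟨v, hv⟩ := key w
    have xy : (x : WithOne X) * y = e := by
      rw [hy, ← mul_assoc, ← mul_assoc, xe, hz, heM]
    have vx : (v : WithOne X) * x = e := by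
      rw [hv, mul_assoc, ex, mul_assoc, hw, heM]
    have ey : (e : WithOne X) * y = y := by
      rw [hy, ← mul_assoc, ← mul_assoc, heM]
    have ye : (y : WithOne X) * e = y := by
      rw [hy, mul_assoc, heM]
    have ve : (v : WithOne X) * e = v := by
      rw [hv, mul_assoc, heM]
    have vy : (v : WithOne X) = y := by
      rw [← ve, ← xy, ← mul_assoc, vx, ey]
    rw [vy] at vx
    exact ⟨by exact_mod_cast ex, by exact_mod_cast xe, y, by exact_mod_cast ey,
      by exact_mod_cast ye, by exact_mod_cast xy, by exact_mod_cast vx⟩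
  · rintro ⟨ex, xe, y, -, -, xy, yx⟩
    have exM : (e : WithOne X) * x = x := by rw [← WithOne.coe_mul, ex]
    have xeM : (x : WithOne X) * e = x := by rw [← WithOne.coe_mul, xe]
    have xyM : (x : WithOne X) * y = e := by rw [← WithOne.coe_mul, xy]
    have yxM : (y : WithOne X) * x = e := by rw [← WithOne.coe_mul, yx]
    constructor
    · ext t
      constructor
      · rintro ⟨z, rfl⟩
        exact ⟨x * z, by simp only [← mul_assoc, exM]⟩
      · rintro ⟨z, rfl⟩
        exact ⟨y * z, by simp only [← mul_assoc, xyM]⟩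
    · ext t
      constructor
      · rintro ⟨z, rfl⟩
        exact ⟨z * x, by simp only [mul_assoc, xeM]⟩
      · rintro ⟨z, rfl⟩
        exact ⟨z * y, by simp only [mul_assoc, yxM]⟩

theorem hclass_mul_aux {X : Type u} [Semigroup X] (e : X) (he : e * e = e) (a b : X)
    (ha : a ∈ HClass e) (hb : b ∈ HClass e) : a * b ∈ HClass e := by
  rw [hclass_iff_aux e he] at *
  obtain ⟨ea, ae, a', ea', ae', h1, h2⟩ := ha
  obtain ⟨eb, be, b', eb', be', h3, h4⟩ := hb
  refine ⟨by rw [← mul_assoc, ea], by rw [mul_assoc, be], b' * a', by rw [← mul_assoc, eb'],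
    by rw [mul_assoc, ae'], ?_, ?_⟩
  · rw [mul_assoc, ← mul_assoc b, h3, ea', h1]
  · rw [mul_assoc, ← mul_assoc a', h2, eb, h4]

theorem heOverE_mul_aux {X : Type u} [Semigroup X] (e : X) (he : e * e = e) (a b : X)
    (ha : a ∈ HeOverE e) (hb : b ∈ HeOverE e) : a * b ∈ HeOverE e := by
  obtain ⟨a1, a2⟩ := ha
  obtain ⟨b1, b2⟩ := hb
  refine ⟨by rw [mul_assoc, b1, ← mul_assoc, a1, mul_assoc], ?_⟩
  have : e * (a * b) = (e * a) * (e * b) := by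
    rw [mul_assoc, ← mul_assoc a, a1, ← mul_assoc, ← mul_assoc, ← mul_assoc, he]
  rw [this]
  exact hclass_mul_aux e he _ _ a2 b2

theorem bool_mul_aux (a b : Bool) : a * b = true ↔ a = true ∧ b = true := by
  revert a b; decide

theorem mem_upClass_aux {X : Type u} [Semigroup X] (e x : X) :
    x ∈ upClass e ↔ ∀ χ : X →ₙ* Bool, χ e = true → χ x = true := Iff.rfl

theorem self_mem_aux {X : Type u} [Semigroup X] (e : X) (he : e * e = e) : e ∈ HeOverE e :=
  ⟨rfl, by rw [he]; exact ⟨rfl, rfl⟩⟩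

theorem heOverE_eq_aux {X : Type u} [Semigroup X] (e : X) (he : e * e = e)
    (h : IsIdealSet (HeOverE e)ᶜ) : HeOverE e = upClass e := by
  classical
  ext x
  rw [mem_upClass_aux]
  constructor
  · rintro ⟨-, h2⟩ χ hχ
    obtain ⟨-, -, y, -, -, h3, -⟩ := (hclass_iff_aux e he _).1 h2
    rw [← h3, map_mul, map_mul, bool_mul_aux, bool_mul_aux] at hχ
    exact hχ.1.2
  · intro hx
    let χ : X →ₙ* Bool :=
      { toFun := fun t => decide (t ∈ HeOverE e)
        map_mul' := by
          intro a b
          rw [Bool.eq_iff_iff, bool_mul_aux, decide_eq_true_iff, decide_eq_true_iff,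
            decide_eq_true_iff]
          constructor
          · intro hab
            exact ⟨by_contra fun ha => (h a ha b).1 hab, by_contra fun hb => (h b hb a).2 hab⟩
          · rintro ⟨ha, hb⟩
            exact heOverE_mul_aux e he a b ha hb }
    exact of_decide_eq_true (hx χ (decide_eq_true (self_mem_aux e he)))

/-- An idempotent `e` is viable (`H_e/e` is a coideal) iff `H_e/e = ⇑e`; in this case
`H_e` is an ideal of the semigroup `⇑e` and `e` commutes with every element of `⇑e`. -/
theorem stmt_13 {X : Type u} [Semigroup X] (e : X) (he : e * e = e) :
    (IsIdealSet (HeOverE e)ᶜ ↔ HeOverE e = upClass e) ∧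
    (IsIdealSet (HeOverE e)ᶜ →
      (∀ a ∈ HClass e, ∀ x ∈ upClass e, a * x ∈ HClass e ∧ x * a ∈ HClass e) ∧
      ∀ x ∈ upClass e, e * x = x * e) := by
  refine ⟨⟨heOverE_eq_aux e he, ?_⟩, ?_⟩
  · intro h
    rw [h]
    intro a ha x
    refine ⟨fun hc => ha fun χ hχ => ?_, fun hc => ha fun χ hχ => ?_⟩
    · have := hc χ hχ
      rw [map_mul, bool_mul_aux] at this
      exact this.1
    · have := hc χ hχ
      rw [map_mul, bool_mul_aux] at this
      exact this.2
  · intro h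
    rw [← heOverE_eq_aux e he h]
    refine ⟨?_, fun x hx => hx.1.symm⟩
    rintro a ha x ⟨h1, h2⟩
    obtain ⟨ea, ae, -⟩ := (hclass_iff_aux e he a).1 ha
    constructor
    · have := hclass_mul_aux e he _ _ ha h2
      rwa [← mul_assoc, ae] at this
    · have := hclass_mul_aux e he _ _ h2 ha
      rwa [← h1, mul_assoc, ea] at this
end

section
/- Let X be an E-separated E-semigroup. Then: (1) the set E(X) of idempotents of X is a semilattice (idempotents commute); (2) for any idempotent e, the maximal subgroup H_e is an ideal in the semigroup ⇑e; (3) for any idempotent e and any x ∈ ⇑e, ex = xe ∈ H_e; (4) for any idempotents x, y ∈ E(X), x ≲ y holds if and only if xy = x. -/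
universe u

theorem mem_HClass_iff {X : Type u} [Semigroup X] {e : X} (he : e * e = e) (a : X) :
    a ∈ HClass e ↔ e * a = a ∧ a * e = a ∧ ∃ b, e * b = b ∧ b * e = b ∧ a * b = e ∧ b * a = e := by
  constructor
  · rintro ⟨h1, h2⟩
    have ha1 : e * a = a := by
      have : (a : WithOne X) ∈ Set.range fun z : WithOne X => (e : WithOne X) * z := by
        rw [← h1]; exact ⟨1, mul_one _⟩
      obtain ⟨z, hz⟩ := this
      have : ((e * a : X) : WithOne X) = a := by
        simp only at hz
        rw [WithOne.coe_mul, ← hz, ← mul_assoc, ← WithOne.coe_mul, he]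
      exact WithOne.coe_inj.mp this
    have ha2 : a * e = a := by
      have : (a : WithOne X) ∈ Set.range fun z : WithOne X => z * (e : WithOne X) := by
        rw [← h2]; exact ⟨1, one_mul _⟩
      obtain ⟨z, hz⟩ := this
      have : ((a * e : X) : WithOne X) = a := by
        simp only at hz
        rw [WithOne.coe_mul, ← hz, mul_assoc, ← WithOne.coe_mul, he]
      exact WithOne.coe_inj.mp this
    have hb : ∃ b, a * b = e := by
      have : (e : WithOne X) ∈ Set.range fun z : WithOne X => (a : WithOne X) * z := by
        rw [h1]; exact ⟨1, mul_one _⟩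
      obtain ⟨z, hz⟩ := this
      simp only at hz
      induction z with
      | one => 
        rw [mul_one] at hz
        have := WithOne.coe_inj.mp hz
        exact ⟨e, by rw [this, he]⟩
      | coe z => exact ⟨z, WithOne.coe_inj.mp (by rw [WithOne.coe_mul]; exact hz)⟩
    have hc : ∃ c, c * a = e := by
      have : (e : WithOne X) ∈ Set.range fun z : WithOne X => z * (a : WithOne X) := by
        rw [h2]; exact ⟨1, one_mul _⟩
      obtain ⟨z, hz⟩ := this
      simp only at hz
      induction z with
      | one => 
        rw [one_mul] at hz
        have := WithOne.coe_inj.mp hz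
        exact ⟨e, by rw [this, he]⟩
      | coe z => exact ⟨z, WithOne.coe_inj.mp (by rw [WithOne.coe_mul]; exact hz)⟩
    obtain ⟨b, hb⟩ := hb
    obtain ⟨c, hc⟩ := hc
    have hbc : e * b = c * e := by rw [← hb, ← mul_assoc, hc, hb]
    refine ⟨ha1, ha2, e * b, by rw [← mul_assoc, he], by rw [hbc, mul_assoc, he],
      by rw [← mul_assoc, ha2, hb], by rw [hbc, mul_assoc, ha1, hc]⟩
  · rintro ⟨h1, h2, b, -, -, hab, hba⟩
    have k1 := congrArg (fun x : X => (x : WithOne X)) h1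
    have k2 := congrArg (fun x : X => (x : WithOne X)) h2
    have k3 := congrArg (fun x : X => (x : WithOne X)) hab
    have k4 := congrArg (fun x : X => (x : WithOne X)) hba
    simp only [WithOne.coe_mul] at k1 k2 k3 k4
    constructor
    · ext t
      constructor
      · rintro ⟨z, rfl⟩
        exact ⟨a * z, by simp only [← mul_assoc, k1]⟩
      · rintro ⟨z, rfl⟩
        exact ⟨b * z, by simp only [← mul_assoc, k3]⟩
    · ext t
      constructor
      · rintro ⟨z, rfl⟩
        exact ⟨z * a, by simp only [mul_assoc, k2]⟩
      · rintro ⟨z, rfl⟩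
        exact ⟨z * b, by simp only [mul_assoc, k4]⟩

/-- Idempotents with the same image in every semilattice coincide. -/
theorem ESeparated.eq_of {X : Type u} [Semigroup X] (hsep : ESeparated X) {x y : X}
    (hx : x * x = x) (hy : y * y = y)
    (H : ∀ (Y : Type u) (mul : Y → Y → Y) (h : X → Y),
      (∀ a b c : Y, mul (mul a b) c = mul a (mul b c)) →
      (∀ a b : Y, mul a b = mul b a) →
      (∀ a b : X, h (a * b) = mul (h a) (h b)) → h x = h y) : x = y := by
  by_contra hne
  obtain ⟨Y, mul, h, h1, h2, -, h4, h5⟩ := hsep x y hx hy hne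
  exact h5 (H Y mul h h1 h2 h4)

theorem HeOverE_mul {X : Type u} [Semigroup X] {e : X} (he : e * e = e) {x y : X}
    (hx : x ∈ HeOverE e) (hy : y ∈ HeOverE e) : x * y ∈ HeOverE e := by
  obtain ⟨hx1, hx2⟩ := hx
  obtain ⟨hy1, hy2⟩ := hy
  rw [mem_HClass_iff he] at hx2 hy2
  obtain ⟨-, x1, b, b1, b2, b3, b4⟩ := hx2
  obtain ⟨y0, y1, c, c1, c2, c3, c4⟩ := hy2
  have hc : x * y * e = e * (x * y) := by rw [mul_assoc, hy1, ← mul_assoc, hx1, mul_assoc]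
  refine ⟨hc, (mem_HClass_iff he _).2 ⟨by rw [← mul_assoc, he], by rw [mul_assoc, hc, ← mul_assoc, he],
    c * b, by rw [← mul_assoc, c1], by rw [mul_assoc, b2], ?_, ?_⟩⟩
  · calc e * (x * y) * (c * b) = (e * x) * (y * c) * b := by simp only [mul_assoc]
      _ = (e * x * e) * (y * c) * b := by rw [x1]
      _ = (e * x) * (e * y * c) * b := by simp only [mul_assoc]
      _ = e * x * e * b := by rw [c3]
      _ = e := by rw [x1, b3]
  · calc c * b * (e * (x * y)) = c * (b * (e * x)) * y := by simp only [mul_assoc]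
      _ = c * (e * y) := by rw [b4, mul_assoc]
      _ = e := c4

theorem HeOverE_of_mul {X : Type u} [Semigroup X] (hsep : ESeparated X) {e : X} (he : e * e = e)
    {x y : X} (h : x * y ∈ HeOverE e) : x ∈ HeOverE e ∧ y ∈ HeOverE e := by
  obtain ⟨h1, h2⟩ := h
  rw [mem_HClass_iff he] at h2
  obtain ⟨-, -, g, g1, g2, g3, g4⟩ := h2
  have e1 : x * y * g = e := by rw [← g1, ← mul_assoc, h1, g3]
  have e2 : g * (x * y) = e := by
    nth_rewrite 1 [← g2]; rw [mul_assoc, g4]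
  have hi : (y * g * x) * (y * g * x) = y * g * x := by
    calc (y * g * x) * (y * g * x) = y * (g * (x * y * g)) * x := by simp only [mul_assoc]
      _ = y * g * x := by rw [e1, g2]
  have e3 : y * g * x = e := by
    refine hsep.eq_of hi he fun Y mul k k1 k2 k3 => ?_
    rw [← e1, k3, k3, k3, k3, k2 _ (k x), k1]
  have hx : x * e = e * x := by
    nth_rewrite 2 [← e1]
    rw [← e3]; simp only [mul_assoc]
  have hy : y * e = e * y := by
    nth_rewrite 2 [← e3]
    rw [← e2]; simp only [mul_assoc]
  have hgx : g * x * e = g * x := by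
    rw [mul_assoc, hx, ← mul_assoc, g2]
  have hyg : e * (y * g) = y * g := by
    rw [← mul_assoc, ← hy, mul_assoc, g1]
  refine ⟨⟨hx, (mem_HClass_iff he _).2 ⟨by rw [← mul_assoc, he], by rw [mul_assoc, hx, ← mul_assoc, he],
    y * g, hyg, by rw [mul_assoc, g2], ?_, ?_⟩⟩,
    ⟨hy, (mem_HClass_iff he _).2 ⟨by rw [← mul_assoc, he], by rw [mul_assoc, hy, ← mul_assoc, he],
    g * x, by rw [← mul_assoc, g1], hgx, ?_, ?_⟩⟩⟩
  · rw [mul_assoc, ← mul_assoc x, e1, he]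
  · rw [← hx, ← mul_assoc, e3, he]
  · rw [mul_assoc, ← mul_assoc y, e3, he]
  · rw [← hy, ← mul_assoc, mul_assoc g, e2, he]

theorem upClass_subset_HeOverE {X : Type u} [Semigroup X] (hsep : ESeparated X) {e : X}
    (he : e * e = e) {x : X} (hx : x ∈ upClass e) : x ∈ HeOverE e := by
  classical
  let χ : X →ₙ* Bool :=
    { toFun := fun z => decide (z ∈ HeOverE e)
      map_mul' := fun a b => by
        have : a * b ∈ HeOverE e ↔ a ∈ HeOverE e ∧ b ∈ HeOverE e :=
          ⟨HeOverE_of_mul hsep he, fun h => HeOverE_mul he h.1 h.2⟩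
        change decide (a * b ∈ HeOverE e) = (decide (a ∈ HeOverE e) && decide (b ∈ HeOverE e))
        simp [this] }
  have h := hx χ
  have hee : e ∈ HeOverE e := ⟨rfl, by rw [he]; exact ⟨rfl, rfl⟩⟩
  have h1 : χ e = true := decide_eq_true hee
  rw [h1] at h
  have h2 : χ x = true := by
    revert h; cases χ x <;> decide
  exact of_decide_eq_true h2

/-- Properties of an `E`-separated `E`-semigroup: (1) idempotents commute (so `E(X)` is a
semilattice); (2) for any idempotent `e`, `H_e` is an ideal of the semigroup `⇑e`;
(3) for any idempotent `e` and `x ∈ ⇑e`, `ex = xe ∈ H_e`; (4) for idempotents `x, y`,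
`x ≲ y` iff `xy = x`. -/
theorem stmt_17 {X : Type u} [Semigroup X] (hsep : ESeparated X)
    (hE : ∀ e f : X, e * e = e → f * f = f → (e * f) * (e * f) = e * f) :
    (∀ e f : X, e * e = e → f * f = f → e * f = f * e) ∧
    (∀ e : X, e * e = e →
      ∀ a ∈ HClass e, ∀ x ∈ upClass e, a * x ∈ HClass e ∧ x * a ∈ HClass e) ∧
    (∀ e : X, e * e = e → ∀ x ∈ upClass e, e * x = x * e ∧ x * e ∈ HClass e) ∧
    (∀ x y : X, x * x = x → y * y = y → (binLe x y ↔ x * y = x)) := by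
  refine ⟨?_, ?_, ?_, ?_⟩
  · intro e f he hf
    refine hsep.eq_of (hE e f he hf) (hE f e hf he) fun Y mul k k1 k2 k3 => ?_
    rw [k3, k3, k2]
  · intro e he a ha x hx
    have ha' := (mem_HClass_iff he a).1 ha
    have haE : a ∈ HeOverE e := ⟨by rw [ha'.1, ha'.2.1], by rw [ha'.1]; exact ha⟩
    have hxE := upClass_subset_HeOverE hsep he hx
    have r1 := (HeOverE_mul he haE hxE).2
    have r2 := HeOverE_mul he hxE haE
    rw [← mul_assoc, ha'.1] at r1
    refine ⟨r1, ?_⟩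
    have := r2.2
    rwa [← r2.1, mul_assoc, ha'.2.1] at this
  · intro e he x hx
    obtain ⟨h1, h2⟩ := upClass_subset_HeOverE hsep he hx
    exact ⟨h1.symm, by rw [h1]; exact h2⟩
  · intro x y hx hy
    constructor
    · intro h
      obtain ⟨-, h2⟩ := upClass_subset_HeOverE hsep hx (x := y) h
      rw [mem_HClass_iff hx] at h2
      obtain ⟨-, h3, b, -, -, h4, -⟩ := h2
      have := hE x y hx hy
      calc x * y = x * y * x := h3.symm
        _ = x * y * (x * y * b) := by rw [h4]
        _ = x * y * (x * y) * b := by rw [mul_assoc (x * y) (x * y) b]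
        _ = x := by rw [this, h4]
    · intro h χ
      have h1 : χ x * χ y = χ x := by rw [← map_mul, h]
      have h2 : (χ x && χ y) = χ x := h1
      revert h2
      cases χ x <;> cases χ y <;> decide
end
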